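/- Let n ≥ 4 be an integer. There exists a function u : ℝⁿ → ℝ of class C² with compact support contained in ℝⁿ \ {0} such that ∫_{ℝⁿ} |x|^{2-n} |∇u(x)|² dx ≠ 0 and ∫_{ℝⁿ} |x|^{4-n} |Δu(x)|² dx < (n-2)² ∫_{ℝⁿ} |x|^{2-n} |∇u(x)|² dx. (Thus for α = 4-n and n ≥ 4 the best constant n-1 is strictly smaller than the best radial constant (n-2)², and symmetry breaking occurs.) -/

import Mathlib

open MeasureTheory

noncomputable def lap {n : ℕ} (u : EuclideanSpace ℝ (Fin n) → ℝ)
    (x : EuclideanSpace ℝ (Fin n)) : ℝ :=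
  ∑ i : Fin n, iteratedFDeriv ℝ 2 u x ![EuclideanSpace.single i 1, EuclideanSpace.single i 1]

open Real Set Filter Topology

theorem integral_Ioi_eq_integral_exp (g : ℝ → ℝ) :
    ∫ r in Ioi (0 : ℝ), g r = ∫ t, exp t * g (exp t) := by
  have h := integral_image_eq_integral_abs_deriv_smul (s := univ) (f := exp) (f' := exp)
    MeasurableSet.univ (fun x _ => (hasDerivAt_exp x).hasDerivWithinAt) exp_injective.injOn g
  simpa [image_univ, range_exp] using h

theorem integral_norm_rpow_mul_radial {n : ℕ} (hn : 1 ≤ n) (a : ℝ) (G : ℝ → ℝ) :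
    ∫ x : EuclideanSpace ℝ (Fin n), ‖x‖ ^ (a - n) * G ‖x‖ =
      n * volume.real (Metric.ball (0 : EuclideanSpace ℝ (Fin n)) 1) *
        ∫ t, exp (a * t) * G (exp t) := by
  have : Nonempty (Fin n) := ⟨⟨0, hn⟩⟩
  rw [integral_fun_norm_addHaar volume (fun r => r ^ (a - n) * G r), integral_Ioi_eq_integral_exp]
  simp only [finrank_euclideanSpace_fin, smul_eq_mul, nsmul_eq_mul]
  rw [mul_assoc]
  congr 3
  ext t
  have hexp : exp t * exp t ^ (n - 1) * exp t ^ (a - n) = exp (a * t) := by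
    rw [← exp_nat_mul, ← exp_mul, ← exp_add, ← exp_add, Nat.cast_sub hn]
    congr 1
    push_cast
    ring
  rw [← hexp]
  ring

theorem integrable_norm_rpow_mul {E : Type*} [NormedAddCommGroup E]
    [MeasurableSpace E] [OpensMeasurableSpace E] {μ : Measure E} [IsFiniteMeasureOnCompacts μ]
    (a : ℝ) {G : E → ℝ} (hG : Continuous G) (hc : HasCompactSupport G) (h0 : (0 : E) ∉ tsupport G) :
    Integrable (fun x => ‖x‖ ^ a * G x) μ := by
  refine Continuous.integrable_of_hasCompactSupport ?_ hc.mul_left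
  refine continuous_iff_continuousAt.2 fun x => ?_
  by_cases hx : x = 0
  · subst hx
    refine (continuousAt_const (y := (0 : ℝ))).congr ?_
    filter_upwards [notMem_tsupport_iff_eventuallyEq.1 h0] with y hy
    simp [hy]
  · exact (continuous_norm.continuousAt.rpow_const (Or.inl (norm_ne_zero_iff.2 hx))).mul
      hG.continuousAt

theorem continuous_gradient {E : Type*} [NormedAddCommGroup E] [InnerProductSpace ℝ E]
    [CompleteSpace E] {u : E → ℝ} (hu : ContDiff ℝ 2 u) : Continuous (gradient u) :=
  (InnerProductSpace.toDual ℝ E).symm.continuous.comp (hu.continuous_fderiv (by norm_num))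

theorem integrable_norm_rpow_mul_gradient_sq {n : ℕ} (a : ℝ)
    {u : EuclideanSpace ℝ (Fin n) → ℝ} (hu : ContDiff ℝ 2 u) (hc : HasCompactSupport u)
    (h0 : 0 ∉ tsupport u) : Integrable (fun x => ‖x‖ ^ a * ‖gradient u x‖ ^ 2) := by
  have hs : tsupport (fun x => ‖gradient u x‖ ^ 2) ⊆ tsupport u := by
    refine closure_minimal (fun x hx => ?_) isClosed_closure
    by_contra h
    exact hx (by simp [gradient, fderiv_of_notMem_tsupport ℝ h])
  exact integrable_norm_rpow_mul a ((continuous_gradient hu).norm.pow 2)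
    (hc.of_isClosed_subset isClosed_closure hs) (fun h => h0 (hs h))

theorem continuous_lap {n : ℕ} {u : EuclideanSpace ℝ (Fin n) → ℝ} (hu : ContDiff ℝ 2 u) :
    Continuous (lap u) :=
  continuous_finsetSum _ fun i _ =>
    (continuous_eval_const (F := ContinuousMultilinearMap ℝ
      (fun _ : Fin 2 => EuclideanSpace ℝ (Fin n)) ℝ)
      ![EuclideanSpace.single i 1, EuclideanSpace.single i 1]).comp
      (hu.continuous_iteratedFDeriv (m := 2) le_rfl)

theorem integrable_norm_rpow_mul_lap_sq {n : ℕ} (a : ℝ)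
    {u : EuclideanSpace ℝ (Fin n) → ℝ} (hu : ContDiff ℝ 2 u) (hc : HasCompactSupport u)
    (h0 : 0 ∉ tsupport u) : Integrable (fun x => ‖x‖ ^ a * lap u x ^ 2) := by
  have hs : tsupport (fun x => lap u x ^ 2) ⊆ tsupport u := by
    refine closure_minimal (fun x hx => ?_) isClosed_closure
    by_contra h
    have h' : iteratedFDeriv ℝ 2 u x = 0 := by
      by_contra h2
      exact h (support_iteratedFDeriv_subset 2 h2)
    exact hx (by simp [lap, h'])
  exact integrable_norm_rpow_mul a ((continuous_lap hu).pow 2)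
    (hc.of_isClosed_subset isClosed_closure hs) (fun h => h0 (hs h))

section CoordinateTimesRadial

variable {n : ℕ} {H : ℝ → ℝ}

theorem hasFDerivAt_coord_mul_radial (i : Fin n) (x : EuclideanSpace ℝ (Fin n)) {H' : ℝ}
    (hH : HasDerivAt H H' (‖x‖ ^ 2)) :
    HasFDerivAt (fun x : EuclideanSpace ℝ (Fin n) => x i * H (‖x‖ ^ 2))
      (H (‖x‖ ^ 2) • EuclideanSpace.proj i + (2 * x i * H') • innerSL ℝ x) x := by
  have h1 : HasFDerivAt (fun x : EuclideanSpace ℝ (Fin n) => x i)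
      (EuclideanSpace.proj i : EuclideanSpace ℝ (Fin n) →L[ℝ] ℝ) x :=
    (EuclideanSpace.proj i : EuclideanSpace ℝ (Fin n) →L[ℝ] ℝ).hasFDerivAt
  have h2 := hH.comp_hasFDerivAt x (hasStrictFDerivAt_norm_sq x).hasFDerivAt
  refine (h1.mul h2).congr_fderiv ?_
  ext v
  simp
  ring

theorem gradient_coord_mul_radial (i : Fin n) (x : EuclideanSpace ℝ (Fin n)) {H' : ℝ}
    (hH : HasDerivAt H H' (‖x‖ ^ 2)) :
    gradient (fun x : EuclideanSpace ℝ (Fin n) => x i * H (‖x‖ ^ 2)) x =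
      H (‖x‖ ^ 2) • EuclideanSpace.single i 1 + (2 * x i * H') • x := by
  apply HasGradientAt.gradient
  rw [hasGradientAt_iff_hasFDerivAt]
  refine (hasFDerivAt_coord_mul_radial i x hH).congr_fderiv ?_
  ext v
  simp [EuclideanSpace.inner_single_left]

theorem sum_norm_gradient_coord_mul_radial_sq (x : EuclideanSpace ℝ (Fin n)) {H' : ℝ}
    (hH : HasDerivAt H H' (‖x‖ ^ 2)) :
    ∑ i, ‖gradient (fun x : EuclideanSpace ℝ (Fin n) => x i * H (‖x‖ ^ 2)) x‖ ^ 2 =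
      n * H (‖x‖ ^ 2) ^ 2 + 4 * ‖x‖ ^ 2 * H (‖x‖ ^ 2) * H' + 4 * ‖x‖ ^ 4 * H' ^ 2 := by
  have h (i : Fin n) : ‖gradient (fun x : EuclideanSpace ℝ (Fin n) => x i * H (‖x‖ ^ 2)) x‖ ^ 2 =
      H (‖x‖ ^ 2) ^ 2 + x i ^ 2 * (4 * H (‖x‖ ^ 2) * H' + 4 * ‖x‖ ^ 2 * H' ^ 2) := by
    rw [gradient_coord_mul_radial i x hH, norm_add_sq_real, norm_smul, norm_smul, mul_pow, mul_pow,
      inner_smul_left, inner_smul_right, EuclideanSpace.inner_single_left]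
    simp [mul_pow]
    ring
  simp_rw [h, Finset.sum_add_distrib, ← Finset.sum_mul, ← EuclideanSpace.real_norm_sq_eq]
  simp
  ring

theorem contDiff_coord_mul_radial {k : WithTop ℕ∞} (i : Fin n) (hH : ContDiff ℝ k H) :
    ContDiff ℝ k (fun x : EuclideanSpace ℝ (Fin n) => x i * H (‖x‖ ^ 2)) :=
  (EuclideanSpace.proj i : EuclideanSpace ℝ (Fin n) →L[ℝ] ℝ).contDiff.mul
    (hH.comp (contDiff_norm_sq ℝ))

theorem lap_coord_mul_radial (i : Fin n) (x : EuclideanSpace ℝ (Fin n)) {H' : ℝ → ℝ} {H'' : ℝ}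
    (h2 : ContDiff ℝ 2 H) (hH : ∀ s, HasDerivAt H (H' s) s) (hH' : HasDerivAt H' H'' (‖x‖ ^ 2)) :
    lap (fun x : EuclideanSpace ℝ (Fin n) => x i * H (‖x‖ ^ 2)) x =
      x i * (4 * ‖x‖ ^ 2 * H'' + (2 * n + 4) * H' (‖x‖ ^ 2)) := by
  have hd := (((contDiff_coord_mul_radial i h2).fderiv_right (m := 1) le_rfl).differentiable
    one_ne_zero) x
  have h (j : Fin n) : iteratedFDeriv ℝ 2 (fun x : EuclideanSpace ℝ (Fin n) => x i * H (‖x‖ ^ 2)) x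
      ![EuclideanSpace.single j 1, EuclideanSpace.single j 1] =
      (if i = j then 4 * x j * H' (‖x‖ ^ 2) else 0) + x j ^ 2 * (4 * x i * H'') +
        2 * x i * H' (‖x‖ ^ 2) := by
    set e : EuclideanSpace ℝ (Fin n) := EuclideanSpace.single j 1
    rw [iteratedFDeriv_two_apply]
    have hc := (hd.hasFDerivAt.clm_apply (hasFDerivAt_const e x)).fderiv
    have hf : (fun y => fderiv ℝ (fun x : EuclideanSpace ℝ (Fin n) => x i * H (‖x‖ ^ 2)) y e) =
        fun y => (if i = j then H (‖y‖ ^ 2) else 0) + 2 * ((y i * H' (‖y‖ ^ 2)) * y j) := by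
      ext y
      rw [(hasFDerivAt_coord_mul_radial i y (hH _)).fderiv]
      simp [e, PiLp.single_apply, EuclideanSpace.inner_single_right]
      ring
    have hj : HasFDerivAt (fun x : EuclideanSpace ℝ (Fin n) => x j)
        (EuclideanSpace.proj j : EuclideanSpace ℝ (Fin n) →L[ℝ] ℝ) x :=
      (EuclideanSpace.proj j : EuclideanSpace ℝ (Fin n) →L[ℝ] ℝ).hasFDerivAt
    have hr := (hH (‖x‖ ^ 2)).comp_hasFDerivAt x (hasStrictFDerivAt_norm_sq x).hasFDerivAt
    have hm := ((hasFDerivAt_coord_mul_radial i x hH').mul hj).const_mul 2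
    rw [hf] at hc
    have hval := DFunLike.congr_fun hc e
    simp only [Matrix.cons_val_zero, Matrix.cons_val_one]
    have : fderiv ℝ (fderiv ℝ (fun x : EuclideanSpace ℝ (Fin n) => x i * H (‖x‖ ^ 2))) x e e =
      fderiv ℝ (fun y : EuclideanSpace ℝ (Fin n) =>
        (if i = j then H (‖y‖ ^ 2) else 0) + 2 * ((y i * H' (‖y‖ ^ 2)) * y j)) x e := by
      rw [hval]
      simp
    rw [this]
    split_ifs with hij
    · subst hij
      have hs := (hr.add hm).fderiv
      refine (DFunLike.congr_fun hs e).trans ?_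
      simp [e, EuclideanSpace.inner_single_right]
      ring
    · have hs := ((hasFDerivAt_const (0 : ℝ) x).add hm).fderiv
      refine (DFunLike.congr_fun hs e).trans ?_
      simp [e, hij, EuclideanSpace.inner_single_right]
      ring
  simp_rw [lap, h, Finset.sum_add_distrib, ← Finset.sum_mul, ← EuclideanSpace.real_norm_sq_eq]
  simp
  ring

theorem sum_lap_coord_mul_radial_sq (x : EuclideanSpace ℝ (Fin n)) {H' : ℝ → ℝ} {H'' : ℝ}
    (h2 : ContDiff ℝ 2 H) (hH : ∀ s, HasDerivAt H (H' s) s) (hH' : HasDerivAt H' H'' (‖x‖ ^ 2)) :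
    ∑ i, lap (fun x : EuclideanSpace ℝ (Fin n) => x i * H (‖x‖ ^ 2)) x ^ 2 =
      ‖x‖ ^ 2 * (4 * ‖x‖ ^ 2 * H'' + (2 * n + 4) * H' (‖x‖ ^ 2)) ^ 2 := by
  simp_rw [lap_coord_mul_radial _ x h2 hH hH', mul_pow, ← Finset.sum_mul,
    ← EuclideanSpace.real_norm_sq_eq]

theorem tsupport_coord_mul_radial_subset {a b : ℝ} (hHab : ∀ s, s ∉ Icc a b → H s = 0)
    (i : Fin n) : tsupport (fun x : EuclideanSpace ℝ (Fin n) => x i * H (‖x‖ ^ 2)) ⊆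
      {x | ‖x‖ ^ 2 ∈ Icc a b} := by
  refine closure_minimal (fun x hx => ?_) (isClosed_Icc.preimage (by fun_prop))
  by_contra h
  exact hx (by simp [hHab _ h])

theorem hasCompactSupport_coord_mul_radial {a b : ℝ} (hHab : ∀ s, s ∉ Icc a b → H s = 0)
    (i : Fin n) :
    HasCompactSupport (fun x : EuclideanSpace ℝ (Fin n) => x i * H (‖x‖ ^ 2)) := by
  refine (isCompact_closedBall (0 : EuclideanSpace ℝ (Fin n)) √b).of_isClosed_subset
    isClosed_closure ((tsupport_coord_mul_radial_subset hHab i).trans fun x hx => ?_)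
  rw [mem_closedBall_zero_iff]
  exact le_sqrt_of_sq_le hx.2

theorem zero_notMem_tsupport_coord_mul_radial {a b : ℝ} (ha : 0 < a)
    (hHab : ∀ s, s ∉ Icc a b → H s = 0) (i : Fin n) :
    0 ∉ tsupport (fun x : EuclideanSpace ℝ (Fin n) => x i * H (‖x‖ ^ 2)) := fun h => by
  have := (tsupport_coord_mul_radial_subset hHab i h).1
  norm_num at this
  linarith

end CoordinateTimesRadial

theorem exists_integral_deriv_sq_lt {c d : ℝ} (hc : 0 < c) :
    ∃ f : ℝ → ℝ, ContDiff ℝ 2 f ∧ HasCompactSupport f ∧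
      (∫ t, deriv (deriv f) t ^ 2) + d * (∫ t, deriv f t ^ 2) < c * ∫ t, f t ^ 2 := by
  let g : ContDiffBump (0 : ℝ) := default
  have hg : ContDiff ℝ 2 g := g.contDiff
  have hI : 0 < ∫ t, g t ^ 2 := by
    refine (hg.continuous.pow 2).integral_pos_of_hasCompactSupport_nonneg_nonzero
      (g.hasCompactSupport.comp_left (g := fun y : ℝ => y ^ 2) (by simp)) (fun t => sq_nonneg _)
      (x := 0) ?_
    simp [g.one_of_mem_closedBall (Metric.mem_closedBall_self g.rIn_pos.le)]
  set I₁ := ∫ t, deriv g t ^ 2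
  set I₂ := ∫ t, deriv (deriv g) t ^ 2
  have hlim : Tendsto (fun ε : ℝ => ε ^ 4 * I₂ + d * (ε ^ 2 * I₁)) (𝓝[>] 0) (𝓝 0) := by
    have : Continuous fun ε : ℝ => ε ^ 4 * I₂ + d * (ε ^ 2 * I₁) := by fun_prop
    simpa using (this.tendsto 0).mono_left nhdsWithin_le_nhds
  obtain ⟨ε, hε, hε0⟩ :=
    ((hlim.eventually_lt_const (mul_pos hc hI)).and self_mem_nhdsWithin).exists
  replace hε0 : 0 < ε := hε0
  have hd1 : deriv (fun t => g (ε * t)) = fun t => ε * deriv g (ε * t) := by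
    ext t
    simpa using deriv_comp_mul_left ε g t
  have hd2 : deriv (fun t => ε * deriv g (ε * t)) = fun t => ε ^ 2 * deriv (deriv g) (ε * t) := by
    ext t
    rw [deriv_const_mul_field, deriv_comp_mul_left ε (deriv g) t, smul_eq_mul, sq, mul_assoc]
  refine ⟨fun t => g (ε * t), hg.comp (contDiff_const.mul contDiff_id),
    g.hasCompactSupport.comp_homeomorph (Homeomorph.mulLeft₀ ε hε0.ne'), ?_⟩
  rw [hd1, hd2]
  simp only [mul_pow, integral_const_mul]
  rw [Measure.integral_comp_mul_left (fun t => g t ^ 2),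
    Measure.integral_comp_mul_left (fun t => deriv g t ^ 2),
    Measure.integral_comp_mul_left (fun t => deriv (deriv g) t ^ 2)]
  rw [abs_of_pos (inv_pos.2 hε0)]
  simp only [smul_eq_mul]
  calc (ε ^ 2) ^ 2 * (ε⁻¹ * I₂) + d * (ε ^ 2 * (ε⁻¹ * I₁))
      = ε⁻¹ * (ε ^ 4 * I₂ + d * (ε ^ 2 * I₁)) := by ring
    _ < ε⁻¹ * (c * ∫ t, g t ^ 2) := mul_lt_mul_of_pos_left hε (inv_pos.2 hε0)
    _ = c * (ε⁻¹ * ∫ t, g t ^ 2) := by ring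

theorem integrable_sq_of_hasCompactSupport {f : ℝ → ℝ} (hf : Continuous f)
    (hc : HasCompactSupport f) : Integrable fun t => f t ^ 2 := by
  simp only [sq]
  exact (hf.mul hf).integrable_of_hasCompactSupport hc.mul_right

theorem integral_deriv_deriv_add_deriv_sub_sq {f : ℝ → ℝ} (hf : ContDiff ℝ 2 f)
    (hc : HasCompactSupport f) (p q : ℝ) :
    ∫ t, (deriv (deriv f) t + p * deriv f t - q * f t) ^ 2 =
      (∫ t, deriv (deriv f) t ^ 2) + (p ^ 2 + 2 * q) * (∫ t, deriv f t ^ 2) +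
        q ^ 2 * ∫ t, f t ^ 2 := by
  have hf1 : ContDiff ℝ 1 (deriv f) := hf.deriv'
  have hc1 : Continuous (deriv f) := hf1.continuous
  have hc2 : Continuous (deriv (deriv f)) := hf1.continuous_deriv_one
  have h0 (t : ℝ) : HasDerivAt f (deriv f t) t := (hf.differentiable two_ne_zero t).hasDerivAt
  have h1 (t : ℝ) : HasDerivAt (deriv f) (deriv (deriv f) t) t :=
    (hf1.differentiable one_ne_zero t).hasDerivAt
  have i0 := integrable_sq_of_hasCompactSupport hf.continuous hc
  have i1 := integrable_sq_of_hasCompactSupport hc1 hc.deriv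
  have i2 := integrable_sq_of_hasCompactSupport hc2 hc.deriv.deriv
  have hff : Integrable fun t => f t * deriv f t :=
    (hf.continuous.mul hc1).integrable_of_hasCompactSupport hc.mul_right
  have hff2 : Integrable fun t => f t * deriv (deriv f) t :=
    (hf.continuous.mul hc2).integrable_of_hasCompactSupport hc.mul_right
  have hf1f2 : Integrable fun t => deriv f t * deriv (deriv f) t :=
    (hc1.mul hc2).integrable_of_hasCompactSupport hc.deriv.mul_right
  have hT : Integrable fun t => 2 * p * (deriv f t * deriv (deriv f) t) -
      2 * p * q * (f t * deriv f t) - 2 * q * (deriv f t ^ 2 + f t * deriv (deriv f) t) :=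
    ((hf1f2.const_mul _).sub (hff.const_mul _)).sub ((i1.add hff2).const_mul _)
  have htot := integral_eq_zero_of_hasDerivAt_of_integrable
    (f := fun t => p * deriv f t ^ 2 - p * q * f t ^ 2 - 2 * q * (f t * deriv f t))
    (fun t => by
      refine (((((h1 t).pow 2).const_mul p).sub (((h0 t).pow 2).const_mul (p * q))).sub
        (((h0 t).mul (h1 t)).const_mul (2 * q))).congr_deriv ?_
      push_cast
      ring)
    hT (((i1.const_mul _).sub (i0.const_mul _)).sub (hff.const_mul _))
  have hsum : Integrable fun t => deriv (deriv f) t ^ 2 + (p ^ 2 + 2 * q) * deriv f t ^ 2 :=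
    i2.add (i1.const_mul _)
  have hmain : Integrable fun t => deriv (deriv f) t ^ 2 + (p ^ 2 + 2 * q) * deriv f t ^ 2 +
      q ^ 2 * f t ^ 2 := hsum.add (i0.const_mul _)
  rw [← integral_const_mul, ← integral_const_mul, ← integral_add i2 (i1.const_mul _),
    ← integral_add hsum (i0.const_mul _), ← add_zero (∫ t, _ + _), ← htot,
    ← integral_add hmain hT]
  congr 1
  ext t
  ring

theorem exists_radial_profile {f : ℝ → ℝ} (hf : ContDiff ℝ 2 f) (hc : HasCompactSupport f) :
    ∃ (H : ℝ → ℝ) (a b : ℝ), 0 < a ∧ ContDiff ℝ 2 H ∧ (∀ s, s ∉ Icc a b → H s = 0) ∧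
      ∀ t, H (exp t ^ 2) = exp (-t) * f t := by
  obtain ⟨R, hR⟩ := (isBounded_iff_forall_norm_le.1 hc.isCompact.isBounded)
  have hfR (t : ℝ) (ht : R < |t|) : f t = 0 :=
    image_eq_zero_of_notMem_tsupport fun h => (hR t h).not_gt ht
  set H : ℝ → ℝ := fun s => (√s)⁻¹ * f (log s / 2) with hHdef
  have hzero (s : ℝ) (hs : s ∉ Icc (exp (-(2 * R))) (exp (2 * R))) : H s = 0 := by
    rcases le_or_gt s 0 with h0 | h0
    · simp [hHdef, sqrt_eq_zero_of_nonpos h0]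
    · rw [hHdef]
      dsimp only
      rw [hfR, mul_zero]
      by_contra! h
      rw [abs_le] at h
      exact hs ⟨(le_log_iff_exp_le h0).1 (by linarith), (log_le_iff_le_exp h0).1 (by linarith)⟩
  refine ⟨H, _, _, exp_pos _, ?_, hzero, fun t => ?_⟩
  · refine contDiff_iff_contDiffAt.2 fun s => ?_
    rcases lt_or_ge s (exp (-(2 * R))) with h | h
    · refine (contDiffAt_const (c := (0 : ℝ))).congr_of_eventuallyEq ?_
      filter_upwards [Iio_mem_nhds h] with y hy
      exact hzero y fun hy' => (hy.not_ge hy'.1)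
    · have hs : 0 < s := (exp_pos _).trans_le h
      exact ((contDiffAt_id.sqrt hs.ne').inv (sqrt_pos.2 hs).ne').mul
        (hf.contDiffAt.comp s ((contDiffAt_log.2 hs.ne').div_const 2))
  · simp [hHdef, sqrt_sq (exp_pos t).le, exp_neg]

theorem deriv_radial_profile {f f' H H' : ℝ → ℝ} {k : ℝ} (hH : ∀ s, HasDerivAt H (H' s) s)
    (hf : ∀ t, HasDerivAt f (f' t) t) (h : ∀ t, H (exp t ^ 2) = exp (-k * t) * f t) (t : ℝ) :
    H' (exp t ^ 2) = exp (-(k + 2) * t) * ((f' t - k * f t) / 2) := by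
  have h1 : HasDerivAt (fun t => H (exp t ^ 2)) (H' (exp t ^ 2) * (2 * exp t * exp t)) t := by
    refine ((hH (exp t ^ 2)).comp t ((hasDerivAt_exp t).pow 2)).congr_deriv ?_
    norm_num
  have h2 : HasDerivAt (fun t => exp (-k * t) * f t)
      (exp (-k * t) * (-k * 1) * f t + exp (-k * t) * f' t) t :=
    (((hasDerivAt_id t).const_mul (-k)).exp).mul (hf t)
  rw [funext h] at h1
  have he : exp (-(k + 2) * t) * (exp t * exp t) = exp (-k * t) := by
    rw [← exp_add, ← exp_add]
    ring_nf
  have hu := h1.unique h2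
  have hpos : exp t * exp t ≠ 0 := by positivity
  refine mul_right_cancel₀ hpos ?_
  linear_combination hu / 2 - (f' t - k * f t) / 2 * he

theorem exists_integral_lap_sq_lt {n : ℕ} (hn : 4 ≤ n) :
    ∃ (H : ℝ → ℝ) (a b : ℝ), 0 < a ∧ ContDiff ℝ 2 H ∧ (∀ s, s ∉ Icc a b → H s = 0) ∧
      (∫ x : EuclideanSpace ℝ (Fin n), ‖x‖ ^ (4 - (n : ℝ)) *
        ∑ i, lap (fun x : EuclideanSpace ℝ (Fin n) => x i * H (‖x‖ ^ 2)) x ^ 2) <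
      ((n : ℝ) - 2) ^ 2 * ∫ x : EuclideanSpace ℝ (Fin n), ‖x‖ ^ (2 - (n : ℝ)) *
        ∑ i, ‖gradient (fun x : EuclideanSpace ℝ (Fin n) => x i * H (‖x‖ ^ 2)) x‖ ^ 2 := by
  have hn' : (4 : ℝ) ≤ n := by exact_mod_cast hn
  obtain ⟨f, hf, hc, hlt⟩ := exists_integral_deriv_sq_lt (d := 2 * ((n : ℝ) - 1))
    (c := ((n : ℝ) - 1) * (((n : ℝ) - 2) ^ 2 - (n - 1))) (by nlinarith)
  obtain ⟨H, a, b, ha, hH, hab, hHf⟩ := exists_radial_profile hf hc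
  refine ⟨H, a, b, ha, hH, hab, ?_⟩
  have hf1 : ContDiff ℝ 1 (deriv f) := hf.deriv'
  have hH1 : ContDiff ℝ 1 (deriv H) := hH.deriv'
  have df (t : ℝ) : HasDerivAt f (deriv f t) t := (hf.differentiable two_ne_zero t).hasDerivAt
  have df1 (t : ℝ) : HasDerivAt (deriv f) (deriv (deriv f) t) t :=
    (hf1.differentiable one_ne_zero t).hasDerivAt
  have dH (t : ℝ) : HasDerivAt H (deriv H t) t := (hH.differentiable two_ne_zero t).hasDerivAt
  have dH1 (t : ℝ) : HasDerivAt (deriv H) (deriv (deriv H) t) t :=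
    (hH1.differentiable one_ne_zero t).hasDerivAt
  have hHf1 := deriv_radial_profile (k := 1) dH df (by simpa using hHf)
  have hHf2 := deriv_radial_profile dH1
    (fun t => ((df1 t).sub ((df t).const_mul 1)).div_const 2) hHf1
  simp only [sum_lap_coord_mul_radial_sq _ hH dH (dH1 _),
    sum_norm_gradient_coord_mul_radial_sq _ (dH _)]
  rw [integral_norm_rpow_mul_radial (by lia) 4 (fun r => r ^ 2 *
      (4 * r ^ 2 * deriv (deriv H) (r ^ 2) + (2 * n + 4) * deriv H (r ^ 2)) ^ 2),
    integral_norm_rpow_mul_radial (by lia) 2 (fun r => n * H (r ^ 2) ^ 2 +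
      4 * r ^ 2 * H (r ^ 2) * deriv H (r ^ 2) + 4 * r ^ 4 * deriv H (r ^ 2) ^ 2)]
  have hA (t : ℝ) : exp (4 * t) * (exp t ^ 2 * (4 * exp t ^ 2 * deriv (deriv H) (exp t ^ 2) +
      (2 * n + 4) * deriv H (exp t ^ 2)) ^ 2) =
      (deriv (deriv f) t + (n - 2) * deriv f t - (n - 1) * f t) ^ 2 := by
    have e1 : exp (-(1 + 2 + 2) * t) = (exp t ^ 5)⁻¹ := by
      rw [← exp_nat_mul, ← exp_neg]; norm_num
    have e2 : exp (-(1 + 2) * t) = (exp t ^ 3)⁻¹ := by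
      rw [← exp_nat_mul, ← exp_neg]; norm_num
    have e3 : exp (4 * t) = exp t ^ 4 := by rw [← exp_nat_mul]; norm_num
    rw [hHf2, hHf1, e1, e2, e3, Pi.sub_apply]
    field_simp
    ring
  have hB (t : ℝ) : exp (2 * t) * (n * H (exp t ^ 2) ^ 2 +
      4 * exp t ^ 2 * H (exp t ^ 2) * deriv H (exp t ^ 2) +
      4 * exp t ^ 4 * deriv H (exp t ^ 2) ^ 2) = (n - 1) * f t ^ 2 + deriv f t ^ 2 := by
    have e2 : exp (-(1 + 2) * t) = (exp t ^ 3)⁻¹ := by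
      rw [← exp_nat_mul, ← exp_neg]; norm_num
    have e3 : exp (2 * t) = exp t ^ 2 := by rw [← exp_nat_mul]; norm_num
    rw [hHf1, hHf, e2, e3, exp_neg]
    field_simp
    ring
  simp only [hA, hB]
  rw [integral_deriv_deriv_add_deriv_sub_sq hf hc, integral_add
    ((integrable_sq_of_hasCompactSupport hf.continuous hc).const_mul _)
    (integrable_sq_of_hasCompactSupport hf1.continuous hc.deriv), integral_const_mul,
    mul_left_comm]
  have hvol : 0 < volume.real (Metric.ball (0 : EuclideanSpace ℝ (Fin n)) 1) :=
    ENNReal.toReal_pos (Metric.measure_ball_pos _ _ one_pos).ne' measure_ball_lt_top.ne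
  refine mul_lt_mul_of_pos_left ?_ (by positivity)
  linarith

theorem statement5 (n : ℕ) (hn : 4 ≤ n) :
    ∃ u : EuclideanSpace ℝ (Fin n) → ℝ,
      ContDiff ℝ 2 u ∧ HasCompactSupport u ∧
      (0 : EuclideanSpace ℝ (Fin n)) ∉ tsupport u ∧
      (∫ x : EuclideanSpace ℝ (Fin n), ‖x‖ ^ (2 - (n : ℝ)) * ‖gradient u x‖ ^ 2) ≠ 0 ∧
      (∫ x : EuclideanSpace ℝ (Fin n), ‖x‖ ^ (4 - (n : ℝ)) * (lap u x) ^ 2) <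
        ((n : ℝ) - 2) ^ 2 *
          (∫ x : EuclideanSpace ℝ (Fin n), ‖x‖ ^ (2 - (n : ℝ)) * ‖gradient u x‖ ^ 2) := by
  obtain ⟨H, a, b, ha, hH, hab, hlt⟩ := exists_integral_lap_sq_lt hn
  have hu (i : Fin n) := contDiff_coord_mul_radial i hH
  have hc (i : Fin n) := hasCompactSupport_coord_mul_radial hab i
  have h0 (i : Fin n) := zero_notMem_tsupport_coord_mul_radial ha hab i
  simp only [Finset.mul_sum] at hlt
  rw [integral_finsetSum _ fun i _ => integrable_norm_rpow_mul_lap_sq _ (hu i) (hc i) (h0 i),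
    integral_finsetSum _ fun i _ => integrable_norm_rpow_mul_gradient_sq _ (hu i) (hc i) (h0 i),
    Finset.mul_sum] at hlt
  obtain ⟨i, -, hi⟩ := Finset.exists_lt_of_sum_lt hlt
  refine ⟨_, hu i, hc i, h0 i, fun hzero => ?_, hi⟩
  rw [hzero, mul_zero] at hi
  exact hi.not_ge (integral_nonneg fun x => by positivity)
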